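/- Let T be the centerless topological N=2 superconformal algebra, V = T⊗T with the adjoint diagonal action, and let d₀ ∈ Der(T, V) be a homogeneous derivation of degree 0 (i.e., d₀(T_j) ⊂ V_j for all j ∈ ℤ). Then d₀(L_0) = 0. -/

import Mathlib

/-!
Common setup: the centerless topological N=2 superconformal algebra `T`,
modelled as the free ℂ-module on basis `{L_n, H_n, G_n, Q_n : n ∈ ℤ}`
(encoded as finitely supported functions `(N2Gen × ℤ) →₀ ℂ`), together with
its super-bracket, the tensor square `TT` and cube `TTT` (modelled as
finitely supported functions on pairs/triples of indices), the adjoint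
diagonal actions, the super-twist and super-cyclic maps, parity and degree
predicates, (inner) super-derivations, the coboundary map `Δ_r = innerDer r`,
the classical Yang–Baxter expression `c(r)`, and the Lie super-bialgebra
predicate.
-/

noncomputable section

/-- The four families of generators of the topological N=2 superconformal algebra. -/
inductive N2Gen : Type
  | L | H | G | Q
  deriving DecidableEq

/-- Index of a basis vector: a generator family together with an integer degree. -/
abbrev N2Idx : Type := N2Gen × ℤ

/-- ℤ/2-parity of a basis vector: `false` = even (`L`, `H`), `true` = odd (`G`, `Q`). -/
def N2parity : N2Idx → Bool
  | (N2Gen.L, _) => false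
  | (N2Gen.H, _) => false
  | (N2Gen.G, _) => true
  | (N2Gen.Q, _) => true

/-- The underlying vector space of the centerless topological N=2 superconformal
algebra: the free ℂ-module on the basis indexed by `N2Idx`. -/
abbrev TopN2 : Type := N2Idx →₀ ℂ

/-- The basis vector `L_n`, `H_n`, `G_n` or `Q_n`. -/
def bT (g : N2Gen) (n : ℤ) : TopN2 := Finsupp.single (g, n) 1

/-- The basis vector with index `i`. -/
def sing (i : N2Idx) : TopN2 := Finsupp.single i 1

/-- The bracket on basis vectors, given by the structure constants of the
centerless topological N=2 superconformal algebra: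
`[L_m,L_n] = (m−n)L_{m+n}`, `[L_m,H_n] = −n H_{m+n}`, `[L_m,G_n] = (m−n)G_{m+n}`,
`[L_m,Q_n] = −n Q_{m+n}`, `[H_m,G_n] = G_{m+n}`, `[H_m,Q_n] = −Q_{m+n}`,
`[G_m,Q_n] = 2L_{m+n} − 2n H_{m+n}`, extended super-skew-symmetrically,
all other brackets of basis vectors being zero. -/
def bracketAux : N2Idx → N2Idx → TopN2
  | (N2Gen.L, m), (N2Gen.L, n) => (m - n : ℂ) • bT N2Gen.L (m + n)
  | (N2Gen.L, m), (N2Gen.H, n) => (-n : ℂ) • bT N2Gen.H (m + n)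
  | (N2Gen.H, m), (N2Gen.L, n) => (m : ℂ) • bT N2Gen.H (m + n)
  | (N2Gen.L, m), (N2Gen.G, n) => (m - n : ℂ) • bT N2Gen.G (m + n)
  | (N2Gen.G, m), (N2Gen.L, n) => (m - n : ℂ) • bT N2Gen.G (m + n)
  | (N2Gen.L, m), (N2Gen.Q, n) => (-n : ℂ) • bT N2Gen.Q (m + n)
  | (N2Gen.Q, m), (N2Gen.L, n) => (m : ℂ) • bT N2Gen.Q (m + n)
  | (N2Gen.H, m), (N2Gen.G, n) => bT N2Gen.G (m + n)
  | (N2Gen.G, m), (N2Gen.H, n) => -(bT N2Gen.G (m + n))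
  | (N2Gen.H, m), (N2Gen.Q, n) => -(bT N2Gen.Q (m + n))
  | (N2Gen.Q, m), (N2Gen.H, n) => bT N2Gen.Q (m + n)
  | (N2Gen.G, m), (N2Gen.Q, n) =>
      (2 : ℂ) • bT N2Gen.L (m + n) + (-2 * n : ℂ) • bT N2Gen.H (m + n)
  | (N2Gen.Q, m), (N2Gen.G, n) =>
      (2 : ℂ) • bT N2Gen.L (m + n) + (-2 * m : ℂ) • bT N2Gen.H (m + n)
  | _, _ => 0

/-- The super-bracket of `T`, extended bilinearly from the basis. -/
def brk (x y : TopN2) : TopN2 :=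
  x.sum fun i a => y.sum fun j b => (a * b) • bracketAux i j

/-- The sign `(−1)^b` for a parity `b : Bool` (`false ↦ 1`, `true ↦ −1`). -/
def psgn (b : Bool) : ℂ := if b then -1 else 1

/-- The Koszul sign `(−1)^{[i][j]}` for two basis indices. -/
def ksgn (i j : N2Idx) : ℂ := psgn (N2parity i && N2parity j)

/-- `x` is ℤ/2-homogeneous of parity `q` (i.e. `x ∈ T^q`). -/
def IsParityT (q : Bool) (x : TopN2) : Prop := ∀ i ∈ x.support, N2parity i = q

/-- `x` is ℤ-homogeneous of degree `n` (i.e. `x ∈ T_n = span{L_n,H_n,G_n,Q_n}`). -/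
def IsDegT (n : ℤ) (x : TopN2) : Prop := ∀ i ∈ x.support, i.2 = n

/-- The tensor square `T ⊗ T`, modelled as the free ℂ-module on pairs of indices. -/
abbrev TT : Type := (N2Idx × N2Idx) →₀ ℂ

/-- Parity of a basis vector `e_{q.1} ⊗ e_{q.2}` of `T ⊗ T`. -/
def pparity (q : N2Idx × N2Idx) : Bool := xor (N2parity q.1) (N2parity q.2)

/-- `v ∈ T ⊗ T` is ℤ/2-homogeneous of parity `p`. -/
def IsParityTT (p : Bool) (v : TT) : Prop := ∀ q ∈ v.support, pparity q = p

/-- `v ∈ T ⊗ T` is ℤ-homogeneous of degree `n`, i.e. `v ∈ V_n = Σ_{j+k=n} T_j ⊗ T_k`. -/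
def IsDegTT (n : ℤ) (v : TT) : Prop := ∀ q ∈ v.support, q.1.2 + q.2.2 = n

/-- The tensor product map `T × T → T ⊗ T`. -/
def tmul2 (x y : TopN2) : TT :=
  x.sum fun i a => y.sum fun j b => Finsupp.single (i, j) (a * b)

/-- Adjoint diagonal action of the basis vector `e_i` on the basis tensor
`e_{q.1} ⊗ e_{q.2}`:  `[e_i,e_{q.1}] ⊗ e_{q.2} + (−1)^{[i][q.1]} e_{q.1} ⊗ [e_i,e_{q.2}]`. -/
def actB (i : N2Idx) (q : N2Idx × N2Idx) : TT :=
  tmul2 (bracketAux i q.1) (sing q.2) + ksgn i q.1 • tmul2 (sing q.1) (bracketAux i q.2)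

/-- The adjoint diagonal action `x · v` of `T` on `V = T ⊗ T`:
`x·(Σ aᵢ⊗bᵢ) = Σ([x,aᵢ]⊗bᵢ + (−1)^{[x][aᵢ]} aᵢ⊗[x,bᵢ])`. -/
def adT2 (x : TopN2) (v : TT) : TT :=
  x.sum fun i a => v.sum fun q c => (a * c) • actB i q

/-- The super-twist map `τ : T⊗T → T⊗T`, `τ(x₁⊗x₂) = (−1)^{[x₁][x₂]} x₂⊗x₁`. -/
def twist (v : TT) : TT :=
  v.sum fun q c => (ksgn q.1 q.2 * c) • Finsupp.single (q.2, q.1) (1 : ℂ)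

/-- The inner derivation `a_inn : x ↦ (−1)^{[a][x]} x·a` attached to `a ∈ T⊗T`
(extended bilinearly over the homogeneous components of `a` and `x`). -/
def innerDer (a : TT) (x : TopN2) : TT :=
  x.sum fun i c => a.sum fun q e =>
    (c * e * psgn (pparity q && N2parity i)) • actB i q

/-- `d : T → V = T⊗T` is a homogeneous super-derivation of parity `p`:
it is ℂ-linear, maps `T^q` into `V^{q+p}`, and satisfies the super Leibniz rule
`d([x,y]) = (−1)^{p[x]} x·d(y) − (−1)^{[y](p+[x])} y·d(x)` on homogeneous elements. -/
def IsHomogDer (p : Bool) (d : TopN2 → TT) : Prop :=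
  (∀ x y : TopN2, d (x + y) = d x + d y) ∧
  (∀ (c : ℂ) (x : TopN2), d (c • x) = c • d x) ∧
  (∀ (q : Bool) (x : TopN2), IsParityT q x → IsParityTT (xor p q) (d x)) ∧
  (∀ (qx qy : Bool) (x y : TopN2), IsParityT qx x → IsParityT qy y →
    d (brk x y) = psgn (p && qx) • adT2 x (d y) - psgn (qy && (xor p qx)) • adT2 y (d x))

/-- The tensor cube `T ⊗ T ⊗ T`, modelled as the free ℂ-module on triples of indices. -/
abbrev TTT : Type := (N2Idx × N2Idx × N2Idx) →₀ ℂ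

/-- The tensor product map `T × T × T → T ⊗ T ⊗ T`. -/
def tmul3 (x y z : TopN2) : TTT :=
  x.sum fun i a => y.sum fun j b => z.sum fun k c => Finsupp.single (i, j, k) (a * b * c)

/-- Adjoint diagonal action of the basis vector `e_i` on a basis vector of `T⊗T⊗T`. -/
def actB3 (i : N2Idx) (q : N2Idx × N2Idx × N2Idx) : TTT :=
  tmul3 (bracketAux i q.1) (sing q.2.1) (sing q.2.2)
    + ksgn i q.1 • tmul3 (sing q.1) (bracketAux i q.2.1) (sing q.2.2)
    + (ksgn i q.1 * ksgn i q.2.1) • tmul3 (sing q.1) (sing q.2.1) (bracketAux i q.2.2)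

/-- The adjoint diagonal action `x · w` of `T` on `T ⊗ T ⊗ T`. -/
def adT3 (x : TopN2) (w : TTT) : TTT :=
  x.sum fun i a => w.sum fun q c => (a * c) • actB3 i q

/-- The classical Yang–Baxter expression
`c(r) = [r^{12},r^{13}] + [r^{12},r^{23}] + [r^{13},r^{23}] ∈ T⊗T⊗T` for `r ∈ T⊗T`,
written out on homogeneous components with the Koszul signs of the super setting:
for components `a⊗b` and `a'⊗b'` of `r`, the summand is
`(−1)^{[a'][b]} [a,a']⊗b⊗b' + a⊗[b,a']⊗b' + (−1)^{[a'][b]} a⊗a'⊗[b,b']`. -/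
def cybe (r : TT) : TTT :=
  r.sum fun q α => r.sum fun q' β => (α * β) •
    ( ksgn q'.1 q.2 • tmul3 (bracketAux q.1 q'.1) (sing q.2) (sing q'.2)
      + tmul3 (sing q.1) (bracketAux q.2 q'.1) (sing q'.2)
      + ksgn q'.1 q.2 • tmul3 (sing q.1) (sing q'.1) (bracketAux q.2 q'.2) )

/-- Tensoring a basis vector of `T` on the left of an element of `T⊗T`. -/
def embedL (i : N2Idx) (w : TT) : TTT :=
  w.sum fun q c => Finsupp.single (i, q.1, q.2) c

/-- The super-cyclic map `ξ : T⊗T⊗T → T⊗T⊗T`,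
`ξ(x₁⊗x₂⊗x₃) = (−1)^{[x₁]([x₂]+[x₃])} x₂⊗x₃⊗x₁`. -/
def cyc (w : TTT) : TTT :=
  w.sum fun q c =>
    (psgn (N2parity q.1 && (xor (N2parity q.2.1) (N2parity q.2.2))) * c) •
      Finsupp.single (q.2.1, q.2.2, q.1) (1 : ℂ)

/-- `(1 ⊗ Δ) : T⊗T → T⊗T⊗T` for a (linear) map `Δ : T → T⊗T` of parity `p`,
with the Koszul sign: `(1⊗Δ)(a⊗b) = (−1)^{p[a]} a ⊗ Δ(b)`. -/
def oneTensor (p : Bool) (D : TopN2 → TT) (v : TT) : TTT :=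
  v.sum fun q c => (psgn (p && N2parity q.1) * c) • embedL q.1 (D (sing q.2))

/-- `(T,[·,·],D)` is a Lie super-bialgebra with comultiplication `D` of parity `p`:
`D` is ℂ-linear, respects the grading, has image in `Im(1⊗1 − τ)`, satisfies the
super co-Jacobi identity `(1 + ξ + ξ²)∘(1⊗D)∘D = 0`, and the compatibility
(1-cocycle) condition `D[x,y] = (−1)^{p[x]} x·D(y) − (−1)^{[y](p+[x])} y·D(x)`. -/
def IsLieSuperBialgebra (p : Bool) (D : TopN2 → TT) : Prop :=
  (∀ x y : TopN2, D (x + y) = D x + D y) ∧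
  (∀ (c : ℂ) (x : TopN2), D (c • x) = c • D x) ∧
  (∀ (q : Bool) (x : TopN2), IsParityT q x → IsParityTT (xor p q) (D x)) ∧
  (∀ x : TopN2, ∃ s : TT, D x = s - twist s) ∧
  (∀ x : TopN2,
    oneTensor p D (D x) + cyc (oneTensor p D (D x)) + cyc (cyc (oneTensor p D (D x))) = 0) ∧
  (∀ (qx qy : Bool) (x y : TopN2), IsParityT qx x → IsParityT qy y →
    D (brk x y) = psgn (p && qx) • adT2 x (D y) - psgn (qy && (xor p qx)) • adT2 y (D x))

end

theorem psgn_ne_zero (b : Bool) : psgn b ≠ 0 := by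
  cases b <;> simp [psgn]

theorem isParityT_sing (i : N2Idx) : IsParityT (N2parity i) (sing i) := by
  intro k hk
  rw [sing, Finsupp.mem_support_single] at hk
  rw [hk.1]

theorem isDegT_sing (i : N2Idx) : IsDegT i.2 (sing i) := by
  intro k hk
  rw [sing, Finsupp.mem_support_single] at hk
  rw [hk.1]

theorem brk_sing_sing (i j : N2Idx) : brk (sing i) (sing j) = bracketAux i j := by
  simp [brk, sing]

theorem adT2_sing (i : N2Idx) (v : TT) : adT2 (sing i) v = v.sum fun q c => c • actB i q := by
  simp [adT2, sing]

theorem tmul2_sing_apply (x : TopN2) (i j k : N2Idx) :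
    tmul2 x (sing j) (i, k) = if j = k then x i else 0 := by
  simp only [tmul2, sing, mul_zero, Finsupp.single_zero, Finsupp.sum_single_index, mul_one]
  rw [Finsupp.sum_apply]
  simp only [Finsupp.single_apply, Prod.mk.injEq]
  rw [Finsupp.sum, Finset.sum_eq_single i]
  · simp
  · intro b _ hb
    simp [hb]
  · intro hi
    simp [Finsupp.notMem_support_iff.mp hi]

theorem sing_tmul2_apply (x : TopN2) (i j k : N2Idx) :
    tmul2 (sing j) x (i, k) = if j = i then x k else 0 := by
  rw [tmul2, sing, Finsupp.sum_single_index (by simp), Finsupp.sum_apply]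
  simp only [one_mul, Finsupp.single_apply, Prod.mk.injEq]
  rw [Finsupp.sum, Finset.sum_eq_single k]
  · simp
  · intro b _ hb
    simp [hb]
  · intro hi
    simp [Finsupp.notMem_support_iff.mp hi]

theorem bracketAux_L_zero (i : N2Idx) :
    bracketAux (N2Gen.L, 0) i = (-i.2 : ℂ) • sing i := by
  obtain ⟨g, n⟩ := i
  cases g <;> simp [bracketAux, bT, sing]

theorem actB_L_zero (q : N2Idx × N2Idx) :
    actB (N2Gen.L, 0) q = (-(q.1.2 + q.2.2 : ℤ) : ℂ) • Finsupp.single q 1 := by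
  obtain ⟨i, j⟩ := q
  ext ⟨k, l⟩
  simp only [actB, bracketAux_L_zero, Finsupp.add_apply, Finsupp.smul_apply, tmul2_sing_apply,
    sing_tmul2_apply, smul_eq_mul]
  by_cases h₁ : i = k <;> by_cases h₂ : j = l <;>
    simp [h₁, h₂, ksgn, N2parity, psgn, sing]
  ring

/-- `L_0` acts on the degree-`n` component of `T ⊗ T` as the scalar `-n`. -/
theorem adT2_L_zero_of_isDegTT {n : ℤ} {v : TT} (hv : IsDegTT n v) :
    adT2 (sing (N2Gen.L, 0)) v = (-n : ℂ) • v := by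
  rw [adT2_sing]
  conv_rhs => rw [← Finsupp.sum_single v, Finsupp.smul_sum]
  refine Finsupp.sum_congr fun q hq => ?_
  rw [actB_L_zero, hv q hq, smul_smul, Finsupp.smul_single, Finsupp.smul_single, smul_eq_mul,
    smul_eq_mul, mul_one, mul_comm]

/-- If `e_i` annihilates `v`, the coefficient of `e_k ⊗ e_j` in `e_i · v` isolates the coefficient
of `e_m ⊗ e_j` in `v` as soon as `e_k` does not occur in `v` on the left, and `e_m` is the only
left tensor factor of `v` whose bracket with `e_i` involves `e_k`. -/
theorem apply_eq_zero_of_adT2_eq_zero {v : TT} {i k m j : N2Idx} (hv : adT2 (sing i) v = 0)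
    (hk : ∀ l, v (k, l) = 0) (hm : bracketAux i m k ≠ 0)
    (huniq : ∀ m', m' ≠ m → v (m', j) ≠ 0 → bracketAux i m' k = 0) :
    v (m, j) = 0 := by
  have h := DFunLike.congr_fun hv (k, j)
  rw [adT2_sing, Finsupp.sum_apply, Finsupp.sum, Finset.sum_eq_single (m, j)] at h
  · by_cases hmk : m = k
    · rw [hmk, hk]
    · simpa [actB, tmul2_sing_apply, sing_tmul2_apply, hmk, hm] using h
  · rintro ⟨m', j'⟩ hq hne
    have hq' := Finsupp.mem_support_iff.mp hq
    have hmk : m' ≠ k := by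
      rintro rfl
      exact hq' (hk _)
    by_cases hj : j' = j
    · subst hj
      have := huniq m' (fun h => hne (by rw [h])) hq'
      simp [actB, tmul2_sing_apply, sing_tmul2_apply, hmk, this]
    · simp [actB, tmul2_sing_apply, sing_tmul2_apply, hmk, hj]
  · intro hq
    simp [Finsupp.notMem_support_iff.mp hq]

theorem exists_bound_left_degree (v : TT) :
    ∃ N : ℤ, ∀ g n l, N < n → v ((g, n), l) = 0 := by
  obtain ⟨N, hN⟩ := (v.support.image fun q => q.1.2).bddAbove
  refine ⟨N, fun g n l hn => ?_⟩
  by_contra hne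
  have := hN (Finset.mem_coe.mpr (Finset.mem_image_of_mem (fun q : N2Idx × N2Idx => q.1.2)
    (Finsupp.mem_support_iff.mpr hne)))
  exact absurd this (not_le.mpr hn)

/-- `T ⊗ T` has no nonzero `T`-invariants. -/
theorem eq_zero_of_forall_adT2_eq_zero {v : TT} (hv : ∀ i, adT2 (sing i) v = 0) : v = 0 := by
  obtain ⟨N, hN⟩ := exists_bound_left_degree v
  have exists_large (a : ℤ) : ∃ n : ℤ, N < n + a ∧ a < n :=
    ⟨max (N - a) a + 1, by omega, by omega⟩
  have hL (a : ℤ) (j : N2Idx) : v ((N2Gen.L, a), j) = 0 := by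
    obtain ⟨n, hn, han⟩ := exists_large a
    refine apply_eq_zero_of_adT2_eq_zero (hv (N2Gen.L, n)) (k := (N2Gen.L, n + a))
      (fun l => hN _ _ _ hn) ?_ ?_
    · have : (n : ℂ) - a ≠ 0 := sub_ne_zero.mpr (by exact_mod_cast han.ne')
      simpa [bracketAux, bT] using this
    · rintro ⟨g, b⟩ hne -
      cases g <;> simp_all [bracketAux, bT]
  have hG (a : ℤ) (j : N2Idx) : v ((N2Gen.G, a), j) = 0 := by
    obtain ⟨n, hn, -⟩ := exists_large a
    refine apply_eq_zero_of_adT2_eq_zero (hv (N2Gen.H, n)) (k := (N2Gen.G, n + a))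
      (fun l => hN _ _ _ hn) ?_ ?_
    · simp [bracketAux, bT]
    · rintro ⟨g, b⟩ hne -
      cases g <;> simp_all [bracketAux, bT]
  have hQ (a : ℤ) (j : N2Idx) : v ((N2Gen.Q, a), j) = 0 := by
    obtain ⟨n, hn, -⟩ := exists_large a
    refine apply_eq_zero_of_adT2_eq_zero (hv (N2Gen.H, n)) (k := (N2Gen.Q, n + a))
      (fun l => hN _ _ _ hn) ?_ ?_
    · simp [bracketAux, bT]
    · rintro ⟨g, b⟩ hne -
      cases g <;> simp_all [bracketAux, bT]
  have hH (a : ℤ) (j : N2Idx) : v ((N2Gen.H, a), j) = 0 := by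
    obtain ⟨n, hn, -⟩ := exists_large a
    refine apply_eq_zero_of_adT2_eq_zero (hv (N2Gen.G, n)) (k := (N2Gen.G, n + a))
      (fun l => hN _ _ _ hn) ?_ ?_
    · simp [bracketAux, bT]
    · rintro ⟨g, b⟩ hne hb
      cases g <;> simp_all [bracketAux, bT]
  ext ⟨⟨g, a⟩, j⟩
  cases g
  exacts [hL a j, hH a j, hG a j, hQ a j]

/-- If `d₀ ∈ Der(T, T⊗T)` is a homogeneous derivation of
degree `0` (i.e. `d₀(T_j) ⊂ V_j` for all `j`), then `d₀(L_0) = 0`. -/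
theorem degree_zero_derivation_kills_L0
    (p : Bool) (d : TopN2 → TT) (hd : IsHomogDer p d)
    (hdeg : ∀ (j : ℤ) (x : TopN2), IsDegT j x → IsDegTT j (d x)) :
    d (bT N2Gen.L 0) = 0 := by
  obtain ⟨-, hsmul, -, hleib⟩ := hd
  refine eq_zero_of_forall_adT2_eq_zero fun i => ?_
  change adT2 (sing i) (d (sing (N2Gen.L, 0))) = 0
  have h := hleib _ _ _ _ (isParityT_sing (N2Gen.L, 0)) (isParityT_sing i)
  rw [brk_sing_sing, bracketAux_L_zero, hsmul,
    adT2_L_zero_of_isDegTT (hdeg _ _ (isDegT_sing i))] at h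
  have hparity : N2parity (N2Gen.L, 0) = false := rfl
  have hsign : psgn false = 1 := rfl
  simpa [hparity, hsign, psgn_ne_zero] using h.symm
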